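/- Let n ≥ 1 and let M be an n-manifold with boundary. Suppose A, B, C : Set M satisfy A ∪ B = Set.univ and A ∩ B = C, and each of A, B, C (with the subspace topology) is homeomorphic to Bⁿ. Then Int(Set.univ) = Int(A) ∪ Int(B); equivalently, no point of the manifold interior of M lies in the set-theoretic complements of Int(A) and Int(B) simultaneously (i.e. in ∂A ∩ ∂B). -/

import Mathlib

noncomputable section

/-- The closed half-space `Hⁿ = {y : ℝⁿ | y 0 ≥ 0}`. -/
def HalfSpace {n : ℕ} (hn : 1 ≤ n) : Set (EuclideanSpace ℝ (Fin n)) :=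
  {y | 0 ≤ y ⟨0, hn⟩}

/-- An `n`-manifold with boundary: every point has an open neighborhood homeomorphic
(as a subspace) to an open subset of the half-space `Hⁿ`.
(The Hausdorff condition is imposed separately via `T2Space`.) -/
def LocallyHalfSpace {n : ℕ} (hn : 1 ≤ n) (M : Type) [TopologicalSpace M] : Prop :=
  ∀ x : M, ∃ (U : Set M) (V : Set (HalfSpace hn)),
    x ∈ U ∧ IsOpen U ∧ IsOpen V ∧ Nonempty (↥U ≃ₜ ↥V)

/-- The manifold interior of a subset `S` of `M`: points `x ∈ S` admitting `U` with
`x ∈ U ⊆ S`, `U` open in the subspace topology of `S`, and `U` homeomorphic to `ℝⁿ`. -/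
def mInt (n : ℕ) {M : Type} [TopologicalSpace M] (S : Set M) : Set M :=
  {x | x ∈ S ∧ ∃ U : Set M, x ∈ U ∧ U ⊆ S ∧
    IsOpen (Subtype.val ⁻¹' U : Set S) ∧
    Nonempty (↥U ≃ₜ EuclideanSpace ℝ (Fin n))}

open Metric Set MeasureTheory


theorem aux_smoothApprox {E : Type*} [NormedAddCommGroup E] [NormedSpace ℝ E]
    [FiniteDimensional ℝ E] {f : E → E} (hf : Continuous f) {K : Set E} (hK : IsCompact K)
    {ε : ℝ} (hε : 0 < ε) :
    ∃ g : E → E, ContDiff ℝ 1 g ∧ ∀ x ∈ K, dist (g x) (f x) < ε := by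
  have : UniformContinuousOn f (cthickening 1 K) :=
    hK.cthickening.uniformContinuousOn_of_continuous <| by fun_prop
  rcases Metric.uniformContinuousOn_iff.mp this (ε / 2) (half_pos hε) with ⟨δ, hδ, hfδ⟩
  rcases hf.exists_contDiff_dist_le_of_forall_mem_ball_dist_le
    (lt_min one_pos hδ) with ⟨g, hgc, hg⟩
  refine ⟨g, hgc.of_le (by exact_mod_cast le_top), fun x hx ↦ (hg _ _ fun y hy ↦ ?_).trans_lt (half_lt_self hε)⟩
  rw [mem_ball, lt_min_iff] at hy
  exact hfδ _ (mem_cthickening_of_dist_le _ x _ _ hx hy.1.le) _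
    (self_subset_cthickening _ hx) hy.2 |>.le

/-- Interpolation of `det (1 + t L)`: polynomial in `t`. -/
theorem aux_det_poly {E : Type*} [NormedAddCommGroup E] [InnerProductSpace ℝ E]
    [FiniteDimensional ℝ E] (L : E →L[ℝ] E) :
    ∃ p : Polynomial ℝ, p.degree < (Module.finrank ℝ E + 1 : ℕ) ∧ ∀ t : ℝ,
      p.eval t = (ContinuousLinearMap.id ℝ _ + t • L).det := by
  let b := Module.finBasis ℝ E
  let m := LinearMap.toMatrix b b (L : E →ₗ[ℝ] E)
  refine ⟨(1 + (Polynomial.X : Polynomial ℝ) • m.map Polynomial.C).det, ?_, ?_⟩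
  · have := Polynomial.natDegree_det_X_add_C_le m 1
    refine lt_of_le_of_lt Polynomial.degree_le_natDegree ?_
    have h2 : (1 + (Polynomial.X : Polynomial ℝ) • m.map Polynomial.C) =
      ((Polynomial.X : Polynomial ℝ) • m.map Polynomial.C + (1 : Matrix (Fin (Module.finrank ℝ E)) (Fin (Module.finrank ℝ E)) ℝ).map Polynomial.C) := by
      rw [add_comm]; simp
    rw [h2]
    simp only [Fintype.card_fin] at this
    exact_mod_cast Nat.lt_succ_of_le this
  · intro t
    rw [← Polynomial.coe_evalRingHom, RingHom.map_det]
    have h3 : (ContinuousLinearMap.id ℝ (E) + t • L).det =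
      LinearMap.det ((ContinuousLinearMap.id ℝ (E) + t • L : E →L[ℝ] E) : E →ₗ[ℝ] E) := rfl
    rw [h3, ← LinearMap.det_toMatrix b]
    congr 1
    ext i j
    have e : ((ContinuousLinearMap.id ℝ E + t • L : E →L[ℝ] E) : E →ₗ[ℝ] E) =
        LinearMap.id + t • (L : E →ₗ[ℝ] E) := rfl
    have e' : LinearMap.toMatrix b b ((ContinuousLinearMap.id ℝ E + t • L : E →L[ℝ] E) : E →ₗ[ℝ] E) = 1 + t • m := by
      rw [e, map_add, LinearMap.toMatrix_id, map_smul]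
    rw [e']
    by_cases hij : i = j
    · subst hij; simp [m]; exact mul_comm _ _
    · simp [m, hij]; exact mul_comm _ _

set_option maxHeartbeats 1000000 in
theorem aux_smooth_no_retraction {E : Type*} [NormedAddCommGroup E] [InnerProductSpace ℝ E]
    [FiniteDimensional ℝ E] [MeasurableSpace E] [BorelSpace E] (f : E → E)
    (hf : ∀ x ∈ closedBall (0 : E) 1, ContDiffAt ℝ 1 f x)
    (h1 : ∀ x ∈ closedBall (0 : E) 1, ‖f x‖ = 1)
    (h2 : ∀ x, ‖x‖ = 1 → f x = x) : False := by
  set n := Module.finrank ℝ E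
  set D := closedBall (0 : E) 1 with hD
  let g : E → E := fun x => f x - x
  have hg : ∀ x ∈ D, ContDiffAt ℝ 1 g x := fun x hx => (hf x hx).sub contDiffAt_id
  have hDc : IsCompact D := isCompact_closedBall _ _
  have hgd : ContinuousOn (fderiv ℝ g) D := fun x hx =>
    ((hg x hx).continuousAt_fderiv (by norm_num)).continuousWithinAt
  obtain ⟨K, hK⟩ := hDc.exists_bound_of_continuousOn hgd
  set K' : NNReal := ⟨max K 1, by positivity⟩ with hK'
  have hK'1 : (1:ℝ) ≤ K' := le_max_right _ _
  have hK'2 : ∀ x ∈ D, ‖fderiv ℝ g x‖ ≤ K' := fun x hx => (hK x hx).trans (le_max_left _ _)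
  have hlip : LipschitzOnWith K' g D :=
    (convex_closedBall (0:E) 1).lipschitzOnWith_of_nnnorm_fderiv_le
      (fun x hx => (hg x hx).differentiableAt (by norm_num)) (fun x hx => hK'2 x hx)
  -- small perturbations of the identity have positive determinant
  obtain ⟨δ, hδ, hdet⟩ : ∃ δ > 0, ∀ L : E →L[ℝ] E, ‖L‖ < δ → 0 < (ContinuousLinearMap.id ℝ E + L).det := by
    have hc : Continuous (fun L : E →L[ℝ] E => (ContinuousLinearMap.id ℝ E + L).det) :=
      ContinuousLinearMap.continuous_det.comp (by fun_prop)
    have h0 : (0:ℝ) < (ContinuousLinearMap.id ℝ E + (0 : E →L[ℝ] E)).det := by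
      rw [add_zero]; exact zero_lt_one.trans_eq (LinearMap.det_id (M := E) (A := ℝ)).symm
    have := hc.continuousAt.eventually (lt_mem_nhds h0)
    rw [Metric.eventually_nhds_iff] at this
    obtain ⟨δ, hδ, h⟩ := this
    exact ⟨δ, hδ, fun L hL => h (by simpa using hL)⟩
  set T : ℝ := min (1/2) (δ / 2) / K' with hT
  have hK'0 : (0:ℝ) < K' := by linarith
  have hT0 : 0 < T := by positivity
  have hTK : T * K' = min (1/2) (δ/2) := by rw [hT]; field_simp
  -- volume identity for small t
  have key : ∀ t : ℝ, 0 < t → t ≤ T →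
      ∫ x in ball (0:E) 1, (ContinuousLinearMap.id ℝ E + t • fderiv ℝ g x).det = (volume (ball (0:E) 1)).toReal := by
    intro t ht0 htT
    have htK : t * K' ≤ min (1/2) (δ/2) := by
      rw [← hTK]; gcongr
    have htK1 : t * K' < 1 := by
      have := htK.trans (min_le_left _ _); linarith
    have htKδ : t * K' < δ := by
      have := htK.trans (min_le_right _ _); linarith
    have ht1 : t < 1 := by nlinarith
    let F : E → E := fun x => x + t • g x
    have hFsph : ∀ x, ‖x‖ = 1 → F x = x := by
      intro x hx; simp [F, g, h2 x hx]
    have hlin : ∀ x ∈ D, ∀ y ∈ D, ‖F x - F y - (x - y)‖ ≤ (t * K') * ‖x - y‖ := by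
      intro x hx y hy
      have h := hlip.dist_le_mul x hx y hy
      rw [dist_eq_norm, dist_eq_norm] at h
      have : F x - F y - (x - y) = t • (g x - g y) := by simp only [F, smul_sub]; abel
      rw [this, norm_smul, Real.norm_of_nonneg ht0.le, mul_assoc]
      gcongr
    have hinj : InjOn F D := by
      intro x hx y hy hxy
      have := hlin x hx y hy
      rw [hxy, sub_self, zero_sub, norm_neg] at this
      have h3 : ‖x - y‖ = 0 := by nlinarith [norm_nonneg (x - y)]
      exact sub_eq_zero.mp (norm_eq_zero.mp h3)
    have hbD : ball (0:E) 1 ⊆ D := ball_subset_closedBall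
    have hopen : IsOpen (F '' ball (0:E) 1) := by
      have hap : ApproximatesLinearOn F ((ContinuousLinearEquiv.refl ℝ E : E ≃L[ℝ] E) : E →L[ℝ] E) (ball (0:E) 1) (⟨t, ht0.le⟩ * K') := by
        intro x hx y hy
        exact hlin x (hbD hx) y (hbD hy)
      have hc : Subsingleton E ∨ (⟨t, ht0.le⟩ * K' : NNReal) < ‖((ContinuousLinearEquiv.refl ℝ E).symm : E →L[ℝ] E)‖₊⁻¹ := by
        rcases subsingleton_or_nontrivial E with h | h
        · exact Or.inl h
        · right
          have : ‖((ContinuousLinearEquiv.refl ℝ E).symm : E →L[ℝ] E)‖₊ = 1 := by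
            ext
            simp
          rw [this, inv_one]
          exact htK1
      exact (hap.toOpenPartialHomeomorph F _ hc isOpen_ball).open_target
    have hmaps : ∀ x ∈ ball (0:E) 1, F x ∈ ball (0:E) 1 := by
      intro x hx
      have hx1 : ‖x‖ < 1 := by simpa using hx
      have : F x = (1 - t) • x + t • f x := by simp only [F, g, smul_sub, sub_smul, one_smul]; abel
      rw [mem_ball_zero_iff, this]
      calc _ ≤ ‖(1 - t) • x‖ + ‖t • f x‖ := norm_add_le _ _
        _ = (1 - t) * ‖x‖ + t * 1 := by
          rw [norm_smul, norm_smul, h1 x (hbD hx), Real.norm_of_nonneg ht0.le, Real.norm_of_nonneg (by linarith)]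
        _ < 1 := by nlinarith
    have himg : F '' ball (0:E) 1 = ball (0:E) 1 := by
      apply Subset.antisymm
      · rintro _ ⟨x, hx, rfl⟩; exact hmaps x hx
      · have hpc : IsPreconnected (ball (0:E) 1) := (convex_ball (0:E) 1).isPreconnected
        refine hpc.subset_of_closure_inter_subset hopen ⟨F 0, hmaps 0 (by simp), mem_image_of_mem _ (by simp)⟩ ?_
        rintro y ⟨hy1, hy2⟩
        have hFc : ContinuousOn F D := by
          intro x hx
          exact (continuousAt_id.add (continuousAt_const.smul (hg x hx).continuousAt)).continuousWithinAt
        have hcl : IsClosed (F '' D) := (hDc.image_of_continuousOn hFc).isClosed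
        have hyD : y ∈ F '' D := closure_minimal (image_mono hbD) hcl hy1
        obtain ⟨x, hx, rfl⟩ := hyD
        refine ⟨x, ?_, rfl⟩
        have hx1 : ‖x‖ ≤ 1 := by simpa [D] using hx
        rcases hx1.lt_or_eq with h | h
        · simpa using h
        · rw [hFsph x h] at hy2; exact hy2
    have hFd : ∀ x ∈ ball (0:E) 1, HasFDerivWithinAt F (ContinuousLinearMap.id ℝ E + t • fderiv ℝ g x) (ball (0:E) 1) x := by
      intro x hx
      have := ((hg x (hbD hx)).differentiableAt (by norm_num)).hasFDerivAt
      exact ((hasFDerivAt_id x).add (this.const_smul t)).hasFDerivWithinAt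
    have hcv := integral_image_eq_integral_abs_det_fderiv_smul volume measurableSet_ball hFd (hinj.mono hbD) (fun _ => (1:ℝ))
    rw [himg] at hcv
    simp only [integral_const, smul_eq_mul, mul_one] at hcv
    rw [show (volume (ball (0:E) 1)).toReal = (volume.restrict (ball (0:E) 1)).real univ by simp [Measure.real], hcv]
    apply setIntegral_congr_fun measurableSet_ball
    intro x hx
    simp only
    rw [abs_of_pos]
    apply hdet
    rw [norm_smul, Real.norm_of_nonneg ht0.le]
    refine lt_of_le_of_lt ?_ htKδ
    gcongr
    exact hK'2 x (hbD hx)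
  have hIntg : ∀ t : ℝ, IntegrableOn (fun x => (ContinuousLinearMap.id ℝ E + t • fderiv ℝ g x).det) (ball (0:E) 1) := by
    intro t
    have : ContinuousOn (fun x => (ContinuousLinearMap.id ℝ E + t • fderiv ℝ g x).det) D :=
      ContinuousLinearMap.continuous_det.comp_continuousOn (continuousOn_const.add (hgd.const_smul t))
    exact (this.integrableOn_compact hDc).mono_set ball_subset_closedBall
  -- determinant vanishes at t = 1
  have hzero : ∀ x ∈ ball (0:E) 1, (ContinuousLinearMap.id ℝ E + (1:ℝ) • fderiv ℝ g x).det = 0 := by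
    intro x hx
    have hxD : x ∈ D := ball_subset_closedBall hx
    have hfd := ((hf x hxD).differentiableAt (by norm_num)).hasFDerivAt
    have hgf : fderiv ℝ g x = fderiv ℝ f x - ContinuousLinearMap.id ℝ E := (hfd.sub (hasFDerivAt_id x)).fderiv
    have e1 : ContinuousLinearMap.id ℝ E + (1:ℝ) • fderiv ℝ g x = fderiv ℝ f x := by
      rw [hgf]; simp
    rw [e1]
    by_contra hne
    have hsurj : Function.Surjective (fderiv ℝ f x) := by
      have hu : IsUnit (LinearMap.det ((fderiv ℝ f x : E →L[ℝ] E) : E →ₗ[ℝ] E)) := isUnit_iff_ne_zero.mpr hne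
      have hu' := (LinearMap.isUnit_iff_isUnit_det _).2 hu
      exact ((Module.End.isUnit_iff _).1 hu').2
    obtain ⟨v, hv⟩ := hsurj (f x)
    have hns := HasFDerivAt.norm_sq (F := E) hfd
    have hconst : (fun y => ‖f y‖ ^ 2) =ᶠ[nhds x] fun _ => (1:ℝ) := by
      filter_upwards [isOpen_ball.mem_nhds hx] with y hy
      rw [h1 y (ball_subset_closedBall hy)]; norm_num
    have h0 := (hasFDerivAt_const (𝕜 := ℝ) (1:ℝ) x).congr_of_eventuallyEq hconst
    have := DFunLike.congr_fun (hns.unique h0) v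
    simp [hv, h1 x hxD] at this
  -- interpolate
  let s : Finset (Fin (n+1)) := Finset.univ
  let node : Fin (n+1) → ℝ := fun i => T / ((i:ℕ) + 1)
  have hnode : Function.Injective node := by
    intro i j hij
    simp only [node] at hij
    have : ((i:ℕ):ℝ) = (j:ℕ) := by
      field_simp at hij; linarith
    exact Fin.ext (by exact_mod_cast this)
  have hnode0 : ∀ i, 0 < node i := fun i => by positivity
  have hnodeT : ∀ i, node i ≤ T := fun i => by
    apply div_le_self hT0.le
    have : (0:ℝ) ≤ (i:ℕ) := by positivity
    linarith
  have hinterp : ∀ x, (ContinuousLinearMap.id ℝ E + (1:ℝ) • fderiv ℝ g x).det =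
      ∑ i ∈ s, (ContinuousLinearMap.id ℝ E + node i • fderiv ℝ g x).det * (Lagrange.basis s node i).eval 1 := by
    intro x
    obtain ⟨p, hp, hpe⟩ := aux_det_poly (fderiv ℝ g x)
    have := Lagrange.eq_interpolate (s := s) (v := node) hnode.injOn (f := p) (by simpa [s] using hp)
    rw [← hpe 1]
    conv_lhs => rw [this]
    rw [Lagrange.interpolate_apply, Polynomial.eval_finsetSum]
    refine Finset.sum_congr rfl fun i _ => ?_
    rw [Polynomial.eval_mul, Polynomial.eval_C, hpe]
  have hsum : ∑ i ∈ s, (Lagrange.basis s node i).eval 1 = 1 := by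
    rw [← Polynomial.eval_finsetSum, Lagrange.sum_basis hnode.injOn ⟨0, by simp [s]⟩]; simp
  have hI0 : ∫ x in ball (0:E) 1, (ContinuousLinearMap.id ℝ E + (1:ℝ) • fderiv ℝ g x).det = 0 := by
    rw [setIntegral_congr_fun measurableSet_ball (g := fun _ => 0) (fun x hx => hzero x hx)]; simp
  have hI1 : ∫ x in ball (0:E) 1, (ContinuousLinearMap.id ℝ E + (1:ℝ) • fderiv ℝ g x).det = (volume (ball (0:E) 1)).toReal := by
    simp_rw [hinterp]
    rw [integral_finsetSum _ (fun i _ => (hIntg (node i)).mul_const _)]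
    simp_rw [integral_mul_const]
    rw [Finset.sum_congr rfl (fun i _ => by rw [key (node i) (hnode0 i) (hnodeT i)]), ← Finset.mul_sum, hsum, mul_one]
  have hvol : 0 < (volume (ball (0:E) 1)).toReal :=
    ENNReal.toReal_pos (measure_ball_pos _ _ one_pos).ne' measure_ball_lt_top.ne
  linarith

theorem aux_brouwer {E : Type} [NormedAddCommGroup E] [InnerProductSpace ℝ E]
    [FiniteDimensional ℝ E] (h : E → E) (hc : Continuous h)
    (hm : ∀ x ∈ closedBall (0 : E) 1, h x ∈ closedBall (0 : E) 1) :
    ∃ x ∈ closedBall (0 : E) 1, h x = x := by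
  by_contra! hno
  borelize E
  have hDc : IsCompact (closedBall (0 : E) 1) := isCompact_closedBall _ _
  obtain ⟨x0, hx0, hmin⟩ := hDc.exists_isMinOn ⟨0, by simp⟩
    (f := fun x => ‖h x - x‖) (by fun_prop)
  set η : ℝ := ‖h x0 - x0‖ / 2 with hη
  have hη0 : 0 < η := by
    have := norm_pos_iff.mpr (sub_ne_zero.mpr (hno x0 hx0)); positivity
  have hmin' : ∀ x ∈ closedBall (0 : E) 1, 2 * η ≤ ‖h x - x‖ := fun x hx => by
    have := hmin hx; simp only [mem_ofPred_eq] at this; linarith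
  obtain ⟨g, hg, hgh⟩ := aux_smoothApprox hc hDc hη0
  let p : E → E := fun x => (1 + η)⁻¹ • g x
  have hp : ContDiff ℝ 1 p := hg.const_smul _
  have hp1 : ∀ x ∈ closedBall (0 : E) 1, ‖p x‖ ≤ 1 := by
    intro x hx
    have h1 := hgh x hx
    rw [dist_eq_norm] at h1
    have h2 : ‖h x‖ ≤ 1 := by simpa using hm x hx
    have h3 : ‖g x‖ ≤ 1 + η := by
      have := norm_le_norm_add_norm_sub' (g x) (h x); linarith
    rw [norm_smul, Real.norm_of_nonneg (by positivity), inv_mul_le_iff₀ (by positivity)]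
    linarith
  have hpx : ∀ x ∈ closedBall (0 : E) 1, x - p x ≠ 0 := by
    intro x hx h0
    have hpe : p x = x := (sub_eq_zero.mp h0).symm
    have hgx : g x = (1 + η) • x := by
      conv_rhs => rw [← hpe]
      simp only [p]; rw [smul_smul, mul_inv_cancel₀ (by positivity), one_smul]
    have h1 := hgh x hx
    rw [dist_eq_norm] at h1
    have hx1 : ‖x‖ ≤ 1 := by simpa using hx
    have : h x - x = η • x - (g x - h x) := by rw [hgx, add_smul, one_smul]; abel
    have h4 := hmin' x hx
    rw [this] at h4
    have h5 := norm_sub_le (η • x) (g x - h x)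
    rw [norm_smul, Real.norm_of_nonneg hη0.le] at h5
    nlinarith
  let v : E → E := fun x => x - p x
  have hv : ContDiff ℝ 1 v := contDiff_id.sub hp
  let Δ : E → ℝ := fun x => (inner ℝ x (v x)) ^ 2 + ‖v x‖ ^ 2 * (1 - ‖x‖ ^ 2)
  have hΔ : ContDiff ℝ 1 Δ :=
    ((contDiff_id.inner ℝ hv).pow 2).add ((hv.norm_sq ℝ).mul (contDiff_const.sub (contDiff_id.norm_sq ℝ)))
  have hsph : ∀ x, ‖x‖ = 1 → 0 < inner ℝ x (v x) := by
    intro x hx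
    have hxD : x ∈ closedBall (0 : E) 1 := by simp [hx]
    have h1 := hp1 x hxD
    have h2 : 0 < ‖v x‖ := norm_pos_iff.mpr (hpx x hxD)
    have h3 : ‖v x‖ ^ 2 = ‖x‖ ^ 2 - 2 * inner ℝ x (p x) + ‖p x‖ ^ 2 := norm_sub_sq_real x (p x)
    have h4 : inner ℝ x (v x) = ‖x‖ ^ 2 - inner ℝ x (p x) := by
      simp only [v]; rw [inner_sub_right, real_inner_self_eq_norm_sq]
    rw [hx] at h3 h4
    nlinarith [norm_nonneg (p x)]
  have hΔpos : ∀ x ∈ closedBall (0 : E) 1, 0 < Δ x := by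
    intro x hx
    have hx1 : ‖x‖ ≤ 1 := by simpa using hx
    have h2 : 0 < ‖v x‖ := norm_pos_iff.mpr (hpx x hx)
    rcases hx1.lt_or_eq with h | h
    · have : 0 < 1 - ‖x‖ ^ 2 := by nlinarith [norm_nonneg x]
      positivity
    · have := hsph x h
      simp only [Δ, h]
      positivity
  let s : E → ℝ := fun x => (-(inner ℝ x (v x)) + √(Δ x)) / ‖v x‖ ^ 2
  let r : E → E := fun x => x + s x • v x
  refine aux_smooth_no_retraction r ?_ ?_ ?_
  · intro x hx
    have h2 : 0 < ‖v x‖ := norm_pos_iff.mpr (hpx x hx)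
    have hs : ContDiffAt ℝ 1 s x :=
      (((contDiff_id.inner ℝ hv).contDiffAt.neg).add (hΔ.contDiffAt.sqrt (hΔpos x hx).ne')).div
        (hv.norm_sq ℝ).contDiffAt (by positivity)
    exact contDiffAt_id.add (hs.smul hv.contDiffAt)
  · intro x hx
    have h2 : 0 < ‖v x‖ := norm_pos_iff.mpr (hpx x hx)
    have h3 : ‖r x‖ ^ 2 = ‖x‖ ^ 2 + 2 * (s x * inner ℝ x (v x)) + (s x) ^ 2 * ‖v x‖ ^ 2 := by
      simp only [r]
      rw [norm_add_sq_real, inner_smul_right, norm_smul, mul_pow, Real.norm_eq_abs, sq_abs]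
    have h4 : s x * ‖v x‖ ^ 2 = -(inner ℝ x (v x)) + √(Δ x) := by
      simp only [s]; field_simp
    have h5 : √(Δ x) ^ 2 = Δ x := Real.sq_sqrt (hΔpos x hx).le
    have h6 : (s x * ‖v x‖ ^ 2 + inner ℝ x (v x)) ^ 2 = (inner ℝ x (v x)) ^ 2 + ‖v x‖ ^ 2 * (1 - ‖x‖ ^ 2) := by
      rw [h4]; rw [← sub_eq_zero]; ring_nf; rw [h5]; simp only [Δ]; ring
    have h7 : ‖v x‖ ^ 2 * ‖r x‖ ^ 2 = ‖v x‖ ^ 2 * 1 := by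
      rw [h3]; linear_combination h6
    have h8 : ‖r x‖ ^ 2 = 1 := mul_left_cancel₀ (by positivity) h7
    nlinarith [norm_nonneg (r x)]
  · intro x hx
    have h1 := hsph x hx
    have : s x = 0 := by
      simp only [s, Δ, hx]
      simp [Real.sqrt_sq h1.le]
    simp [r, this]

theorem aux_brouwer_on {E : Type} [NormedAddCommGroup E] [InnerProductSpace ℝ E]
    [FiniteDimensional ℝ E] (h : E → E) (hc : ContinuousOn h (closedBall 0 1))
    (hm : ∀ x ∈ closedBall (0 : E) 1, h x ∈ closedBall (0 : E) 1) :
    ∃ x ∈ closedBall (0 : E) 1, h x = x := by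
  have : TietzeExtension E := TietzeExtension.of_tvs ℝ
  obtain ⟨g, hg⟩ := ContinuousMap.exists_restrict_eq (isClosed_closedBall (x := (0:E)) (ε := 1))
    ⟨_, hc.domRestrict⟩
  have hgh : ∀ x ∈ closedBall (0 : E) 1, g x = h x := fun x hx =>
    congrArg (fun F => F ⟨x, hx⟩) hg
  obtain ⟨x, hx, e⟩ := aux_brouwer g g.continuous (fun x hx => by rw [hgh x hx]; exact hm x hx)
  exact ⟨x, hx, by rw [← hgh x hx, e]⟩

theorem aux_no_retraction {E : Type} [NormedAddCommGroup E] [InnerProductSpace ℝ E]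
    [FiniteDimensional ℝ E] (r : E → E) (hc : ContinuousOn r (closedBall 0 1))
    (h1 : ∀ x ∈ closedBall (0 : E) 1, ‖r x‖ = 1) (h2 : ∀ x, ‖x‖ = 1 → r x = x) : False := by
  obtain ⟨x, hx, e⟩ := aux_brouwer_on (fun x => - r x) hc.neg
    (fun x hx => by simp [h1 x hx])
  have hx1 : ‖x‖ = 1 := by rw [← e, norm_neg, h1 x hx]
  simp only [h2 x hx1] at e
  have : x = 0 := by
    have h3 : (2:ℝ) • x = 0 := by rw [two_smul]; nth_rewrite 1 [← e]; simp
    simpa using h3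
  simp [this] at hx1

theorem aux_invariance_local {E : Type} [NormedAddCommGroup E] [InnerProductSpace ℝ E]
    [FiniteDimensional ℝ E] (f : E → E) (hc : ContinuousOn f (closedBall 0 1))
    (hi : InjOn f (closedBall 0 1)) : f 0 ∈ interior (f '' closedBall 0 1) := by
  by_contra hnot
  borelize E
  set D := closedBall (0:E) 1 with hD
  have hDc : IsCompact D := isCompact_closedBall _ _
  have h0D : (0:E) ∈ D := by simp [D]
  obtain ⟨G, hG⟩ : ∃ G : C(E, E), ∀ x ∈ D, G (f x) = x := by
    have : CompactSpace D := isCompact_iff_compactSpace.mp hDc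
    have he : Topology.IsClosedEmbedding (fun x : D => f x) :=
      (continuousOn_iff_continuous_domRestrict.mp hc).isClosedEmbedding
        (injOn_iff_injective.mp hi)
    obtain ⟨G, hG⟩ := ContinuousMap.exists_extension' he (⟨Subtype.val, continuous_subtype_val⟩ : C(D, E))
    exact ⟨G, fun x hx => congrFun hG ⟨x, hx⟩⟩
  have hG0 : G (f 0) = 0 := hG 0 h0D
  obtain ⟨ε', hε', hGε⟩ := Metric.continuousAt_iff.mp (G.continuous.continuousAt (x := f 0)) (1/10) (by norm_num)
  set ε := ε' / 3 with hε
  have hε0 : 0 < ε := by positivity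
  have hGsmall : ∀ y, dist y (f 0) < 3 * ε → ‖G y‖ < 1/10 := by
    intro y hy
    have := hGε (x := y) (by linarith)
    rwa [hG0, dist_zero_right] at this
  obtain ⟨c, hcε, hcD⟩ : ∃ c, dist c (f 0) < ε ∧ c ∉ f '' D := by
    by_contra! hh
    exact hnot (mem_interior_iff_mem_nhds.mpr (Metric.mem_nhds_iff.mpr ⟨ε, hε0, fun y hy => hh y hy⟩))
  have hfD : IsCompact (f '' D) := hDc.image_of_continuousOn hc
  set S1 : Set E := f '' D ∩ {y | ε ≤ dist y c} with hS1
  have hS1c : IsCompact S1 := hfD.inter_right (isClosed_le continuous_const (by fun_prop))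
  have hS2c : IsCompact (sphere c ε) := isCompact_sphere _ _
  have hGne : ∀ y ∈ S1, 0 < ‖G y‖ := by
    rintro _ ⟨⟨x, hx, rfl⟩, hy⟩
    rw [hG x hx, norm_pos_iff]
    rintro rfl
    simp only [mem_ofPred_eq] at hy
    rw [dist_comm] at hy
    linarith
  obtain ⟨δ, hδ0, hδ⟩ : ∃ δ > 0, ∀ y ∈ S1, δ ≤ ‖G y‖ := by
    rcases S1.eq_empty_or_nonempty with h | h
    · exact ⟨1, one_pos, by simp [h]⟩
    · obtain ⟨y0, hy0, hm⟩ := hS1c.exists_isMinOn h (f := fun y => ‖G y‖) (by fun_prop)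
      exact ⟨‖G y0‖, hGne y0 hy0, fun y hy => hm hy⟩
  set τ : ℝ := min δ (1/10) / 2 with hτ
  have hτ0 : 0 < τ := by positivity
  have hτδ : 2 * τ ≤ δ := by rw [hτ]; linarith [min_le_left δ (1/10)]
  have hτ1 : 2 * τ ≤ 1/10 := by rw [hτ]; linarith [min_le_right δ (1/10)]
  obtain ⟨P, hP, hPG⟩ := aux_smoothApprox G.continuous (hS1c.union hS2c) hτ0
  obtain ⟨w, hw, hwP⟩ : ∃ w ∈ ball (0:E) τ, w ∉ P '' sphere c ε := by
    by_contra! hh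
    have hnull : volume (P '' sphere c ε) = 0 :=
      addHaar_image_eq_zero_of_differentiableOn_of_addHaar_eq_zero volume
        (hP.differentiable (by norm_num)).differentiableOn
        (Measure.addHaar_sphere_of_ne_zero volume c hε0.ne')
    exact (measure_ball_pos volume (0:E) hτ0).ne' (measure_mono_null hh hnull)
  have hw1 : ‖w‖ < τ := by simpa using hw
  let Q : E → E := fun y => P y - w
  have hQc : Continuous Q := hP.continuous.sub continuous_const
  have hQG : ∀ y ∈ S1 ∪ sphere c ε, ‖G y - Q y‖ < 2 * τ := by
    intro y hy
    have h1 := hPG y hy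
    rw [dist_comm, dist_eq_norm] at h1
    have : G y - Q y = (G y - P y) + w := by simp only [Q]; abel
    rw [this]
    linarith [norm_add_le (G y - P y) w]
  have hQ1 : ∀ y ∈ S1 ∪ sphere c ε, Q y ≠ 0 := by
    intro y hy h0
    rcases hy with hy' | hy'
    · have h1 := hQG y (Or.inl hy')
      rw [h0, sub_zero] at h1
      linarith [hδ y hy']
    · exact hwP ⟨y, hy', sub_eq_zero.mp h0⟩
  let Φ : E → E := fun y => c + (max 1 (ε / ‖y - c‖)) • (y - c)
  have hΦc : ContinuousOn Φ (f '' D) := by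
    intro y hy
    have hne : ‖y - c‖ ≠ 0 := by
      rw [norm_ne_zero_iff, sub_ne_zero]; rintro rfl; exact hcD hy
    apply ContinuousAt.continuousWithinAt
    have h1 : ContinuousAt (fun y => ‖y - c‖) y := by fun_prop
    have h2 : ContinuousAt (fun y => y - c) y := by fun_prop
    exact continuousAt_const.add
      ((continuousAt_const.max (continuousAt_const.div h1 hne)).smul h2)
  have hΦ : ∀ y ∈ f '' D, Φ y ∈ S1 ∪ sphere c ε ∧ ‖G y - Q (Φ y)‖ ≤ 1 := by
    intro y hy
    have hpos : 0 < ‖y - c‖ := by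
      rw [norm_pos_iff, sub_ne_zero]; rintro rfl; exact hcD hy
    rcases le_or_gt ε ‖y - c‖ with h | h
    · have h1 : Φ y = y := by
        simp only [Φ]
        rw [max_eq_left ((div_le_one hpos).mpr h), one_smul]; abel
      have h2 : y ∈ S1 ∪ sphere c ε := Or.inl ⟨hy, by simpa [dist_eq_norm] using h⟩
      rw [h1]
      exact ⟨h2, by linarith [hQG y h2]⟩
    · have h1 : Φ y - c = (ε / ‖y - c‖) • (y - c) := by
        simp only [Φ]
        rw [max_eq_right ((one_le_div hpos).mpr h.le)]; abel
      have h3 : ‖Φ y - c‖ = ε := by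
        rw [h1, norm_smul, Real.norm_of_nonneg (by positivity)]; field_simp
      have h2 : Φ y ∈ S1 ∪ sphere c ε := Or.inr (by simpa [dist_eq_norm] using h3)
      refine ⟨h2, ?_⟩
      have h4 : ‖G y‖ < 1/10 := by
        apply hGsmall
        have := dist_triangle y c (f 0)
        rw [dist_eq_norm y c] at this
        linarith
      have h5 : ‖G (Φ y)‖ < 1/10 := by
        apply hGsmall
        have := dist_triangle (Φ y) c (f 0)
        rw [dist_eq_norm (Φ y) c] at this
        linarith
      have h6 := hQG _ h2
      have : G y - Q (Φ y) = G y - G (Φ y) + (G (Φ y) - Q (Φ y)) := by abel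
      rw [this]
      linarith [norm_add_le (G y - G (Φ y)) (G (Φ y) - Q (Φ y)), norm_sub_le (G y) (G (Φ y))]
  obtain ⟨x, hx, e⟩ := aux_brouwer_on (fun x => x - Q (Φ (f x)))
    (continuousOn_id.sub (hQc.comp_continuousOn (hΦc.comp hc (mapsTo_image f D))))
    (fun x hx => by
      have := (hΦ (f x) (mem_image_of_mem f hx)).2
      rw [hG x hx] at this
      simpa using this)
  exact hQ1 _ (hΦ (f x) (mem_image_of_mem f hx)).1 (by simpa using e)

theorem aux_invariance {E : Type} [NormedAddCommGroup E] [InnerProductSpace ℝ E]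
    [FiniteDimensional ℝ E] (f : E → E) {U : Set E} (hU : IsOpen U) (hc : ContinuousOn f U)
    (hi : InjOn f U) : IsOpen (f '' U) := by
  rw [← subset_interior_iff_isOpen]
  rintro _ ⟨x, hx, rfl⟩
  obtain ⟨r, hr, hrU⟩ := Metric.nhds_basis_closedBall.mem_iff.mp (hU.mem_nhds hx)
  have hm : ∀ y ∈ closedBall (0:E) 1, x + r • y ∈ U := by
    intro y hy
    apply hrU
    have hy1 : ‖y‖ ≤ 1 := by simpa using hy
    rw [mem_closedBall, dist_eq_norm, add_sub_cancel_left, norm_smul, Real.norm_of_nonneg hr.le]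
    nlinarith
  have := aux_invariance_local (fun y => f (x + r • y))
    (hc.comp (by fun_prop) hm)
    (fun y hy z hz h => by
      have := hi (hm y hy) (hm z hz) h
      exact smul_right_injective E hr.ne' (add_left_cancel this))
  simp only [smul_zero, add_zero] at this
  refine interior_mono ?_ this
  rintro _ ⟨y, hy, rfl⟩
  exact ⟨_, hm y hy, rfl⟩

theorem aux_subHomeo {X Y : Type} [TopologicalSpace X] [TopologicalSpace Y] {T : Set X} {K L : Set Y}
    (φ : T ≃ₜ K) (hL : L ⊆ K) :
    ∃ ψ : ({m | ∃ h : m ∈ T, (φ ⟨m, h⟩ : Y) ∈ L} : Set X) ≃ₜ L,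
      ∀ m h (h' : m ∈ T), (ψ ⟨m, h⟩ : Y) = φ ⟨m, h'⟩ := by
  let S : Set X := {m | ∃ h : m ∈ T, (φ ⟨m, h⟩ : Y) ∈ L}
  have hST : ∀ m : S, m.1 ∈ T := fun m => m.2.1
  have hinv : ∀ l : L, ((φ.symm ⟨l.1, hL l.2⟩ : T) : X) ∈ S := fun l =>
    ⟨(φ.symm ⟨l.1, hL l.2⟩).2, by simp⟩
  let ψ : S ≃ₜ L :=
    { toFun := fun m => ⟨φ ⟨m.1, hST m⟩, m.2.2⟩
      invFun := fun l => ⟨φ.symm ⟨l.1, hL l.2⟩, hinv l⟩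
      left_inv := fun m => by simp
      right_inv := fun l => by simp
      continuous_toFun := by fun_prop
      continuous_invFun := by fun_prop }
  exact ⟨ψ, fun m h h' => rfl⟩

theorem aux_subHomeo_open {X Y : Type} [TopologicalSpace X] [TopologicalSpace Y] {T : Set X}
    {K L : Set Y} (φ : T ≃ₜ K) {O : Set Y} (hO : IsOpen O) (hL : ∀ y ∈ K, y ∈ O → y ∈ L) (x : X) (hx : x ∈ T)
    (hxO : (φ ⟨x, hx⟩ : Y) ∈ O) :
    ∃ N : Set X, IsOpen N ∧ x ∈ N ∧ N ∩ T = {m | ∃ h : m ∈ T, (φ ⟨m, h⟩ : Y) ∈ O} ∧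
      N ∩ T ⊆ {m | ∃ h : m ∈ T, (φ ⟨m, h⟩ : Y) ∈ L} := by
  have h1 : IsOpen ((fun t : T => (φ t : Y)) ⁻¹' O) := hO.preimage (by fun_prop)
  obtain ⟨N, hN, e⟩ := isOpen_induced_iff.mp h1
  have e' : ∀ t : T, t.1 ∈ N ↔ (φ t : Y) ∈ O := fun t => by
    have := congrArg (fun s => t ∈ s) e; simpa using this
  have h2 : N ∩ T = {m | ∃ h : m ∈ T, (φ ⟨m, h⟩ : Y) ∈ O} := by
    ext m; constructor
    · rintro ⟨h, h'⟩; exact ⟨h', (e' ⟨m, h'⟩).mp h⟩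
    · rintro ⟨h', h⟩; exact ⟨(e' ⟨m, h'⟩).mpr h, h'⟩
  refine ⟨N, hN, (e' ⟨x, hx⟩).mpr hxO, h2, ?_⟩
  rw [h2]
  rintro m ⟨h, h'⟩
  exact ⟨h, hL _ (φ ⟨m, h⟩).2 h'⟩

theorem aux_ball_homeo {E : Type} [NormedAddCommGroup E] [NormedSpace ℝ E] (c : E) {r : ℝ} (hr : 0 < r) :
    Nonempty (ball c r ≃ₜ E) := by
  let h := (OpenPartialHomeomorph.univBall c r).toHomeomorphSourceTarget
  have h1 : (OpenPartialHomeomorph.univBall c r).source = univ := OpenPartialHomeomorph.univBall_source c r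
  have h2 : (OpenPartialHomeomorph.univBall c r).target = ball c r := OpenPartialHomeomorph.univBall_target c hr
  exact ⟨(Homeomorph.setCongr h2.symm).trans (h.symm.trans ((Homeomorph.setCongr h1).trans (Homeomorph.Set.univ E)))⟩

/-- Shrinking Euclidean neighbourhoods. -/
theorem aux_shrink {M : Type} [TopologicalSpace M] {E : Type} [NormedAddCommGroup E] [NormedSpace ℝ E]
    {U W : Set M} (φ : U ≃ₜ E) {x : M} (hx : x ∈ U) (hW : IsOpen W) (hxW : x ∈ W) :
    ∃ O : Set M, IsOpen O ∧ x ∈ O ∧ O ∩ U ⊆ W ∧ Nonempty (↥(O ∩ U) ≃ₜ E) := by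
  let φ' : U ≃ₜ (univ : Set E) := φ.trans (Homeomorph.Set.univ E).symm
  have h1 : IsOpen (φ.symm ⁻¹' (Subtype.val ⁻¹' W)) := (hW.preimage continuous_subtype_val).preimage φ.symm.continuous
  obtain ⟨r, hr, hrW⟩ := Metric.isOpen_iff.mp h1 (φ ⟨x, hx⟩) (by simpa using hxW)
  obtain ⟨N, hN, hxN, e, -⟩ := aux_subHomeo_open φ' (L := univ) (isOpen_ball (x := φ ⟨x, hx⟩) (ε := r)) (fun _ _ _ => trivial) x hx
    (mem_ball_self hr)
  obtain ⟨ψ, -⟩ := aux_subHomeo φ' (subset_univ (ball (φ ⟨x, hx⟩) r))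
  obtain ⟨β⟩ := aux_ball_homeo (φ ⟨x, hx⟩) hr
  refine ⟨N, hN, hxN, ?_, ?_⟩
  · rw [e]
    rintro m ⟨hm, hm'⟩
    have := hrW hm'
    simpa [φ'] using this
  · exact ⟨(Homeomorph.setCongr e).trans (ψ.trans β)⟩

theorem aux_mInt_of_local {n : ℕ} {M : Type} [TopologicalSpace M] {S U O : Set M} {x : M} (hxU : x ∈ U)
    (φ : U ≃ₜ EuclideanSpace ℝ (Fin n)) (hO : IsOpen O) (hxO : x ∈ O) (h : O ∩ S = O ∩ U) :
    x ∈ mInt n S := by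
  obtain ⟨N, hN, hxN, hNO, hne⟩ := aux_shrink φ hxU hO hxO
  have e : N ∩ U = (N ∩ O) ∩ S := by
    rw [inter_assoc, h, ← inter_assoc]
    ext m; constructor
    · intro hm; exact ⟨⟨hm.1, hNO hm⟩, hm.2⟩
    · intro hm; exact ⟨hm.1.1, hm.2⟩
  have hxS : x ∈ S := (h.symm.subset ⟨hxO, hxU⟩).2
  refine ⟨hxS, N ∩ U, ⟨hxN, hxU⟩, by rw [e]; exact inter_subset_right, ?_, hne⟩
  rw [e]
  have : (Subtype.val ⁻¹' ((N ∩ O) ∩ S) : Set S) = Subtype.val ⁻¹' (N ∩ O) := by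
    ext m; simp
  rw [this]
  exact (hN.inter hO).preimage continuous_subtype_val

theorem aux_open_in {n : ℕ} {M : Type} [TopologicalSpace M] {T U : Set M}
    (hUT : U ⊆ T) (φ : U ≃ₜ EuclideanSpace ℝ (Fin n)) (j : T → EuclideanSpace ℝ (Fin n))
    (hj : Continuous j) (hji : Function.Injective j) :
    ∃ O, IsOpen O ∧ O ∩ T = U := by
  let f : EuclideanSpace ℝ (Fin n) → EuclideanSpace ℝ (Fin n) :=
    fun e => j ⟨φ.symm e, hUT (φ.symm e).2⟩
  have hf : Continuous f := by fun_prop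
  have hfi : Function.Injective f := by
    intro a b hab
    have := congrArg Subtype.val (hji hab)
    exact φ.symm.injective (Subtype.ext this)
  have hR := aux_invariance f isOpen_univ hf.continuousOn hfi.injOn
  obtain ⟨O, hO, e⟩ := isOpen_induced_iff.mp (hR.preimage hj)
  refine ⟨O, hO, ?_⟩
  have e' : ∀ t : T, t.1 ∈ O ↔ j t ∈ f '' univ := fun t => by
    have := congrArg (fun s => t ∈ s) e; simpa using this
  ext m; constructor
  · rintro ⟨h, h'⟩
    obtain ⟨a, -, ha⟩ := (e' ⟨m, h'⟩).mp h
    have := congrArg Subtype.val (hji ha)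
    simp only at this
    rw [← this]
    exact (φ.symm a).2
  · intro h
    exact ⟨(e' ⟨m, hUT h⟩).mpr ⟨φ ⟨m, h⟩, trivial, by simp [f]⟩, hUT h⟩

theorem aux_mInt_subset {n : ℕ} (hn : 1 ≤ n) {M : Type} [TopologicalSpace M]
    (hM : LocallyHalfSpace hn M) (S : Set M) : mInt n S ⊆ mInt n (univ : Set M) := by
  rintro x ⟨hxS, U, hxU, hUS, -, ⟨φ⟩⟩
  obtain ⟨W, V, hxW, hW, hV, ⟨ψ⟩⟩ := hM x
  obtain ⟨O, hO, hxO, hOW, ⟨φ'⟩⟩ := aux_shrink φ hxU hW hxW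
  obtain ⟨O', hO', e⟩ := aux_open_in hOW φ' (fun w => ((ψ w : HalfSpace hn) : EuclideanSpace ℝ (Fin n)))
    (by fun_prop) (fun a b hab => ψ.injective (Subtype.ext (Subtype.ext hab)))
  refine aux_mInt_of_local (U := O ∩ U) ⟨hxO, hxU⟩ φ' (hO'.inter hW) (by rw [e]; exact ⟨hxO, hxU⟩) ?_
  rw [e]; simp

theorem aux_mInt_of_mInt_sub {n : ℕ} {M : Type} [TopologicalSpace M] {A C : Set M} (hCA : C ⊆ A)
    (α : A ≃ₜ closedBall (0 : EuclideanSpace ℝ (Fin n)) 1) : mInt n C ⊆ mInt n A := by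
  rintro x ⟨hxS, U, hxU, hUS, -, ⟨φ⟩⟩
  obtain ⟨O', hO', e⟩ := aux_open_in (hUS.trans hCA) φ (fun a => (α a : EuclideanSpace ℝ (Fin n)))
    (by fun_prop) (fun a b hab => α.injective (Subtype.ext hab))
  refine aux_mInt_of_local hxU φ hO' (e.symm.subset hxU).1 ?_
  rw [e]
  refine (inter_eq_right.mpr ?_).symm
  rw [← e]; exact inter_subset_left

theorem aux_mInt_of_lt {n : ℕ} {M : Type} [TopologicalSpace M] {A : Set M}
    (α : A ≃ₜ closedBall (0 : EuclideanSpace ℝ (Fin n)) 1) {x : M} (hx : x ∈ A)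
    (h : ‖(α ⟨x, hx⟩ : EuclideanSpace ℝ (Fin n))‖ < 1) : x ∈ mInt n A := by
  obtain ⟨N, hN, hxN, e, -⟩ := aux_subHomeo_open α (L := univ)
    (isOpen_ball (x := (0 : EuclideanSpace ℝ (Fin n))) (ε := 1)) (fun _ _ _ => trivial) x hx (by simpa using h)
  obtain ⟨ψ, -⟩ := aux_subHomeo α (ball_subset_closedBall)
  obtain ⟨β⟩ := aux_ball_homeo (0 : EuclideanSpace ℝ (Fin n)) one_pos
  refine aux_mInt_of_local (U := N ∩ A) ⟨hxN, hx⟩ ((Homeomorph.setCongr e).trans (ψ.trans β)) hN hxN ?_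
  simp

/-- Absolute extension property, for closed subsets of a Euclidean space. -/
def AuxExt (E : Type) [TopologicalSpace E] {M : Type} [TopologicalSpace M] (S : Set M) : Prop :=
  ∀ (Z : Set E) (F : E → M), IsClosed Z → ContinuousOn F Z → (∀ z ∈ Z, F z ∈ S) →
    ∃ F' : E → M, Continuous F' ∧ (∀ y, F' y ∈ S) ∧ ∀ z ∈ Z, F' z = F z

theorem aux_ext {E : Type} [NormedAddCommGroup E] [InnerProductSpace ℝ E] [FiniteDimensional ℝ E]
    {M : Type} [TopologicalSpace M] {T : Set M} (τ : T ≃ₜ closedBall (0 : E) 1) {x : M} (hx : x ∈ T)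
    (h : ‖(τ ⟨x, hx⟩ : E)‖ = 1) : AuxExt E (T \ {x}) := by
  intro Z F hZ hF hFT
  -- points of the open ball correspond to points different from x
  have hne : ∀ b : closedBall (0 : E) 1, ‖(b : E)‖ < 1 → (τ.symm b : M) ∈ T \ {x} := by
    intro b hb
    refine ⟨(τ.symm b).2, fun hbx => ?_⟩
    have : τ.symm b = ⟨x, hx⟩ := Subtype.ext hbx
    rw [← this] at h
    simp at h
    linarith
  rcases Z.eq_empty_or_nonempty with rfl | hZne
  · exact ⟨fun _ => τ.symm ⟨0, by simp⟩, continuous_const, fun _ => hne _ (by simp), by simp⟩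
  let F0 : C(Z, closedBall (0 : E) 1) :=
    ⟨fun z => τ ⟨F z, (hFT z z.2).1⟩, τ.continuous.comp ((continuousOn_iff_continuous_domRestrict.mp hF).subtype_mk _)⟩
  have : TietzeExtension (closedBall (0 : E) 1) := Set.instTietzeExtensionUnitClosedBall (𝕜 := ℝ)
  obtain ⟨G, hG⟩ := ContinuousMap.exists_restrict_eq hZ F0
  let u : E → ℝ := fun y => (1 + infDist y Z)⁻¹
  have hu0 : ∀ y, 0 < 1 + infDist y Z := fun y => by linarith [infDist_nonneg (x := y) (s := Z)]
  have hu : Continuous u := (continuous_const.add (continuous_infDist_pt Z)).inv₀ (fun y => (hu0 y).ne')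
  have hnorm : ∀ y, ‖u y • (G y : E)‖ = u y * ‖(G y : E)‖ := fun y => by
    rw [norm_smul, Real.norm_of_nonneg (inv_pos.mpr (hu0 y)).le]
  have hG1 : ∀ y, ‖(G y : E)‖ ≤ 1 := fun y => mem_closedBall_zero_iff.mp (G y).2
  have hu1 : ∀ y, u y ≤ 1 := fun y => inv_le_one_of_one_le₀ (by linarith [infDist_nonneg (x := y) (s := Z)])
  have hmem : ∀ y, u y • (G y : E) ∈ closedBall (0:E) 1 := fun y => by
    rw [mem_closedBall_zero_iff, hnorm]
    exact mul_le_one₀ (hu1 y) (norm_nonneg _) (hG1 y)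
  have hZval : ∀ z ∈ Z, ((τ.symm ⟨u z • (G z : E), hmem z⟩ : T) : M) = F z := by
    intro z hz
    have h1 : u z = 1 := by simp [u, infDist_zero_of_mem hz]
    have h2 : G z = τ ⟨F z, (hFT z hz).1⟩ := DFunLike.congr_fun hG ⟨z, hz⟩
    have h3 : (⟨u z • (G z : E), hmem z⟩ : closedBall (0:E) 1) = τ ⟨F z, (hFT z hz).1⟩ := by
      rw [← h2]; ext1; simp [h1]
    rw [h3]; simp
  refine ⟨fun y => τ.symm ⟨u y • (G y : E), hmem y⟩, by fun_prop, fun y => ?_, hZval⟩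
  by_cases hy : y ∈ Z
  · simp only [hZval y hy]; exact hFT y hy
  · apply hne
    have hpos : 0 < infDist y Z := (hZ.notMem_iff_infDist_pos hZne).mp hy
    have hlt : u y < 1 := inv_lt_one_of_one_lt₀ (by linarith)
    simp only [hnorm]
    have := (inv_pos.mpr (hu0 y))
    calc u y * ‖(G y : E)‖ ≤ u y * 1 := by gcongr; exact hG1 y
      _ < 1 := by linarith

theorem aux_glue {E : Type} [NormedAddCommGroup E] {M : Type} [TopologicalSpace M] {A B C : Set M}
    (hA : AuxExt E A) (hB : AuxExt E B) (hC : AuxExt E C) (hCA : C ⊆ A) (hCB : C ⊆ B)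
    {P Q : Set E} (hP : IsClosed P) (hQ : IsClosed Q) (g : E → M) (hg : ContinuousOn g (P ∪ Q))
    (hgP : ∀ y ∈ P, g y ∈ A) (hgQ : ∀ y ∈ Q, g y ∈ B) (hgPQ : ∀ y ∈ P, y ∈ Q → g y ∈ C) :
    ∃ F : E → M, Continuous F ∧ (∀ y, F y ∈ A ∪ B) ∧ ∀ y ∈ P ∪ Q, F y = g y := by
  classical
  let P' : Set E := {y | infEDist y P ≤ infEDist y Q}
  let Q' : Set E := {y | infEDist y Q ≤ infEDist y P}
  have hP' : IsClosed P' := isClosed_le continuous_infEDist continuous_infEDist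
  have hQ' : IsClosed Q' := isClosed_le continuous_infEDist continuous_infEDist
  have hPP : P ⊆ P' := fun y hy => by simp [P', infEDist_zero_of_mem hy]
  have hQQ : Q ⊆ Q' := fun y hy => by simp [Q', infEDist_zero_of_mem hy]
  have hPQ' : ∀ y ∈ P, y ∈ Q' → y ∈ Q := fun y hy hy' => by
    have : infEDist y Q ≤ infEDist y P := hy'
    rw [infEDist_zero_of_mem hy] at this
    exact (mem_iff_infEDist_zero_of_closed hQ).mpr (le_antisymm this bot_le)
  have hQP' : ∀ y ∈ Q, y ∈ P' → y ∈ P := fun y hy hy' => by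
    have : infEDist y P ≤ infEDist y Q := hy'
    rw [infEDist_zero_of_mem hy] at this
    exact (mem_iff_infEDist_zero_of_closed hP).mpr (le_antisymm this bot_le)
  obtain ⟨h, hc, hhC, hh⟩ := hC (P ∩ Q) g (hP.inter hQ) (hg.mono fun y hy => Or.inl hy.1)
    (fun y hy => hgPQ y hy.1 hy.2)
  let a0 : E → M := fun y => if y ∈ P then g y else h y
  let b0 : E → M := fun y => if y ∈ Q then g y else h y
  have ha0P : ∀ y ∈ P, a0 y = g y := fun y hy => if_pos hy
  have hb0Q : ∀ y ∈ Q, b0 y = g y := fun y hy => if_pos hy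
  have ha0 : ∀ y ∈ P' ∩ Q', a0 y = h y := fun y hy => by
    by_cases hyP : y ∈ P
    · rw [ha0P y hyP, hh y ⟨hyP, hPQ' y hyP hy.2⟩]
    · exact if_neg hyP
  have hb0 : ∀ y ∈ P' ∩ Q', b0 y = h y := fun y hy => by
    by_cases hyQ : y ∈ Q
    · rw [hb0Q y hyQ, hh y ⟨hQP' y hyQ hy.1, hyQ⟩]
    · exact if_neg hyQ
  obtain ⟨a, hac, haA, haa⟩ := hA (P ∪ (P' ∩ Q')) a0 (hP.union (hP'.inter hQ'))
    (((hg.mono subset_union_left).congr ha0P).union_of_isClosed (hc.continuousOn.congr ha0) hP (hP'.inter hQ'))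
    (by
      rintro y (hy | hy)
      · rw [ha0P y hy]; exact hgP y hy
      · rw [ha0 y hy]; exact hCA (hhC y))
  obtain ⟨b, hbc, hbB, hbb⟩ := hB (Q ∪ (P' ∩ Q')) b0 (hQ.union (hP'.inter hQ'))
    (((hg.mono subset_union_right).congr hb0Q).union_of_isClosed (hc.continuousOn.congr hb0) hQ (hP'.inter hQ'))
    (by
      rintro y (hy | hy)
      · rw [hb0Q y hy]; exact hgQ y hy
      · rw [hb0 y hy]; exact hCB (hhC y))
  let F : E → M := fun y => if y ∈ P' then a y else b y
  have hFP : ∀ y ∈ P', F y = a y := fun y hy => if_pos hy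
  have hFQ : ∀ y ∈ Q', F y = b y := fun y hy => by
    by_cases hyP : y ∈ P'
    · rw [hFP y hyP, haa y (Or.inr ⟨hyP, hy⟩), hbb y (Or.inr ⟨hyP, hy⟩), ha0 y ⟨hyP, hy⟩, hb0 y ⟨hyP, hy⟩]
    · exact if_neg hyP
  refine ⟨F, ?_, ?_, ?_⟩
  · have h1 := (hac.continuousOn.congr hFP).union_of_isClosed (hbc.continuousOn.congr hFQ) hP' hQ'
    have h2 : P' ∪ Q' = univ := eq_univ_of_forall fun y =>
      (le_total (infEDist y P) (infEDist y Q)).imp id id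
    rw [h2] at h1
    exact continuousOn_univ.mp h1
  · intro y
    by_cases hyP : y ∈ P'
    · rw [hFP y hyP]; exact Or.inl (haA y)
    · have : F y = b y := if_neg hyP
      rw [this]; exact Or.inr (hbB y)
  · rintro y (hy | hy)
    · rw [hFP y (hPP hy), haa y (Or.inl hy), ha0P y hy]
    · rw [hFQ y (hQQ hy), hbb y (Or.inl hy), hb0Q y hy]

/-- Small half-balls around boundary points. -/
theorem aux_halfball {E : Type} [NormedAddCommGroup E] [InnerProductSpace ℝ E] [FiniteDimensional ℝ E]
    {M : Type} [TopologicalSpace M] {T O : Set M} (τ : T ≃ₜ closedBall (0 : E) 1) {x : M} (hx : x ∈ T)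
    (h : ‖(τ ⟨x, hx⟩ : E)‖ = 1) (hO : IsOpen O) (hxO : x ∈ O) :
    ∃ T1 N : Set M, T1 ⊆ T ∧ T1 ⊆ O ∧ IsOpen N ∧ x ∈ N ∧ N ∩ T ⊆ T1 ∧ AuxExt E (T1 \ {x}) := by
  set p : E := (τ ⟨x, hx⟩ : E) with hp
  have h1 : IsOpen (τ.symm ⁻¹' (Subtype.val ⁻¹' O)) := (hO.preimage continuous_subtype_val).preimage τ.symm.continuous
  obtain ⟨r, hr, hrO⟩ := Metric.isOpen_iff.mp h1 (τ ⟨x, hx⟩) (by simpa using hxO)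
  let L : Set E := closedBall (0:E) 1 ∩ closedBall p (r/2)
  have hLc : Convex ℝ L := (convex_closedBall _ _).inter (convex_closedBall _ _)
  have hLcl : IsClosed L := isClosed_closedBall.inter isClosed_closedBall
  have hLne : (interior L).Nonempty := by
    have hsub : ball (0:E) 1 ∩ ball p (r/2) ⊆ interior L :=
      interior_maximal (inter_subset_inter ball_subset_closedBall ball_subset_closedBall) (isOpen_ball.inter isOpen_ball)
    have hpc : p ∈ closure (ball (0:E) 1) := by
      rw [closure_ball _ one_ne_zero]; simp [h]
    obtain ⟨q, hq1, hq2⟩ := mem_closure_iff.mp hpc (ball p (r/2)) isOpen_ball (mem_ball_self (by positivity))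
    exact ⟨q, hsub ⟨hq2, hq1⟩⟩
  have hpL : p ∈ L := ⟨by simp [h], mem_closedBall_self (by positivity)⟩
  obtain ⟨η, -, hη2, hη3⟩ := exists_homeomorph_image_interior_closure_frontier_eq_unitBall hLc hLne
    (isBounded_closedBall.subset inter_subset_left)
  rw [hLcl.closure_eq] at hη2
  have hpf : p ∈ frontier L := by
    refine ⟨subset_closure hpL, fun hpi => ?_⟩
    have h2 : p ∈ interior (closedBall (0:E) 1) := interior_mono inter_subset_left hpi
    rw [interior_closedBall _ one_ne_zero] at h2
    simp [h] at h2
  have hηp : ‖η p‖ = 1 := by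
    have : η p ∈ sphere (0:E) 1 := hη3 ▸ mem_image_of_mem η hpf
    simpa using this
  obtain ⟨ψ, hψ⟩ := aux_subHomeo τ (L := L) inter_subset_left
  obtain ⟨N, hN, hxN, -, hNT⟩ := aux_subHomeo_open τ (L := L) (isOpen_ball (x := p) (ε := r/2))
    (fun y hy hy' => ⟨hy, ball_subset_closedBall hy'⟩) x hx (mem_ball_self (by positivity))
  have hxT1 : x ∈ {m | ∃ h : m ∈ T, (τ ⟨m, h⟩ : E) ∈ L} := ⟨hx, hpL⟩
  refine ⟨_, N, ?_, ?_, hN, hxN, hNT, aux_ext (ψ.trans ((η.image L).trans (Homeomorph.setCongr hη2))) hxT1 ?_⟩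
  · rintro m ⟨hm, -⟩; exact hm
  · rintro m ⟨hm, hm'⟩
    have : τ ⟨m, hm⟩ ∈ ball (τ ⟨x, hx⟩) r := by
      rw [mem_ball, Subtype.dist_eq]
      have : dist (τ ⟨m, hm⟩ : E) p ≤ r/2 := hm'.2
      linarith
    have := hrO this
    simpa using this
  · have := hψ x hxT1 hx
    change ‖η (ψ ⟨x, hxT1⟩ : E)‖ = 1
    rw [this]; exact hηp

theorem aux_key {n : ℕ} {M : Type} [TopologicalSpace M]
    {A B C U : Set M} (hAc : IsClosed A) (hBc : IsClosed B) (hAB : A ∪ B = univ) (hABC : A ∩ B = C)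
    (α : A ≃ₜ closedBall (0 : EuclideanSpace ℝ (Fin n)) 1)
    (β : B ≃ₜ closedBall (0 : EuclideanSpace ℝ (Fin n)) 1)
    (γ : C ≃ₜ closedBall (0 : EuclideanSpace ℝ (Fin n)) 1)
    {x : M} (hxA : x ∈ A) (hxB : x ∈ B) (hxC : x ∈ C)
    (h1 : ‖(α ⟨x, hxA⟩ : EuclideanSpace ℝ (Fin n))‖ = 1)
    (h2 : ‖(β ⟨x, hxB⟩ : EuclideanSpace ℝ (Fin n))‖ = 1)
    (h3 : ‖(γ ⟨x, hxC⟩ : EuclideanSpace ℝ (Fin n))‖ = 1)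
    (hU : IsOpen U) (hxU : x ∈ U) (φ : U ≃ₜ EuclideanSpace ℝ (Fin n)) : False := by
  obtain ⟨A1, NA, hA1, hA1U, hNA, hxNA, hNA1, extA⟩ := aux_halfball α hxA h1 hU hxU
  obtain ⟨B1, NB, hB1, hB1U, hNB, hxNB, hNB1, extB⟩ := aux_halfball β hxB h2 hU hxU
  obtain ⟨C1, NC, hC1, hC1O, hNC, hxNC, hNC1, extC⟩ := aux_halfball γ hxC h3 (hNA.inter hNB) ⟨hxNA, hxNB⟩
  have hC1A : C1 ⊆ A1 := fun m hm => hNA1 ⟨(hC1O hm).1, (hABC.symm.subset (hC1 hm)).1⟩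
  have hC1B : C1 ⊆ B1 := fun m hm => hNB1 ⟨(hC1O hm).2, (hABC.symm.subset (hC1 hm)).2⟩
  have hO : IsOpen (φ.symm ⁻¹' (Subtype.val ⁻¹' (NA ∩ NB ∩ NC))) :=
    (((hNA.inter hNB).inter hNC).preimage continuous_subtype_val).preimage φ.symm.continuous
  obtain ⟨ε, hε, hεN⟩ := Metric.nhds_basis_closedBall.mem_iff.mp
    (hO.mem_nhds (x := φ ⟨x, hxU⟩) (by simpa using ⟨⟨hxNA, hxNB⟩, hxNC⟩))
  set c := φ ⟨x, hxU⟩ with hc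
  let g : EuclideanSpace ℝ (Fin n) → M := fun s => φ.symm (c + ε • s)
  have hg : Continuous g := by fun_prop
  have hgN : ∀ s ∈ sphere (0 : EuclideanSpace ℝ (Fin n)) 1, g s ∈ NA ∩ NB ∩ NC := by
    intro s hs
    have hs1 : ‖s‖ = 1 := by simpa using hs
    have : c + ε • s ∈ closedBall c ε := by
      rw [mem_closedBall, dist_eq_norm, add_sub_cancel_left, norm_smul, hs1, Real.norm_of_nonneg hε.le, mul_one]
    exact hεN this
  have hgx : ∀ s ∈ sphere (0 : EuclideanSpace ℝ (Fin n)) 1, g s ≠ x := by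
    intro s hs e
    have hs1 : ‖s‖ = 1 := by simpa using hs
    have e1 : φ.symm (c + ε • s) = ⟨x, hxU⟩ := Subtype.ext e
    have e2 : c + ε • s = c := (φ.apply_symm_apply _).symm.trans (congrArg φ e1)
    have e3 : ε • s = 0 := by simpa using e2
    rw [smul_eq_zero] at e3
    rcases e3 with e3 | e3
    · exact hε.ne' e3
    · simp [e3] at hs1
  let P : Set (EuclideanSpace ℝ (Fin n)) := sphere 0 1 ∩ g ⁻¹' A
  let Q : Set (EuclideanSpace ℝ (Fin n)) := sphere 0 1 ∩ g ⁻¹' B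
  have hPQ : ∀ s ∈ sphere (0 : EuclideanSpace ℝ (Fin n)) 1, s ∈ P ∪ Q := by
    intro s hs
    have : g s ∈ A ∪ B := hAB ▸ mem_univ _
    exact this.imp (fun h => ⟨hs, h⟩) (fun h => ⟨hs, h⟩)
  obtain ⟨F, hF, hFAB, hFg⟩ := aux_glue extA extB extC
    (sdiff_subset_sdiff_left hC1A) (sdiff_subset_sdiff_left hC1B)
    (isClosed_sphere.inter (hAc.preimage hg) : IsClosed P)
    (isClosed_sphere.inter (hBc.preimage hg) : IsClosed Q) g hg.continuousOn
    (fun y hy => ⟨hNA1 ⟨(hgN y hy.1).1.1, hy.2⟩, hgx y hy.1⟩)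
    (fun y hy => ⟨hNB1 ⟨(hgN y hy.1).1.2, hy.2⟩, hgx y hy.1⟩)
    (fun y hy hy' => ⟨hNC1 ⟨(hgN y hy.1).2, hABC ▸ ⟨hy.2, hy'.2⟩⟩, hgx y hy.1⟩)
  have hFU : ∀ y, F y ∈ U := fun y => (hFAB y).elim (fun h => hA1U h.1) (fun h => hB1U h.1)
  have hFx : ∀ y, F y ≠ x := fun y => (hFAB y).elim (fun h => h.2) (fun h => h.2)
  let v : EuclideanSpace ℝ (Fin n) → EuclideanSpace ℝ (Fin n) := fun y => φ ⟨F y, hFU y⟩ - c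
  have hv : Continuous v := by fun_prop
  have hv0 : ∀ y, ‖v y‖ ≠ 0 := fun y => by
    rw [norm_ne_zero_iff, sub_ne_zero]
    intro e
    exact hFx y (congrArg Subtype.val (φ.injective e))
  refine aux_no_retraction (fun y => ‖v y‖⁻¹ • v y)
    ((hv.norm.inv₀ hv0).smul hv).continuousOn ?_ ?_
  · intro y _
    rw [norm_smul, norm_inv, norm_norm, inv_mul_cancel₀ (hv0 y)]
  · intro s hs
    have hs' : s ∈ sphere (0 : EuclideanSpace ℝ (Fin n)) 1 := by simpa using hs
    have e1 : (⟨F s, hFU s⟩ : U) = φ.symm (c + ε • s) := Subtype.ext (hFg s (hPQ s hs'))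
    have e2 : v s = ε • s := by simp only [v]; rw [e1]; simp
    simp only [e2]
    rw [norm_smul, hs, mul_one, Real.norm_of_nonneg hε.le, smul_smul, inv_mul_cancel₀ hε.ne', one_smul]

theorem mInt_union_eq (n : ℕ) (hn : 1 ≤ n)
    (M : Type) [TopologicalSpace M] [T2Space M] (hM : LocallyHalfSpace hn M)
    (A B C : Set M) (hAB : A ∪ B = Set.univ) (hABC : A ∩ B = C)
    (hA : Nonempty (↥A ≃ₜ ↥(Metric.closedBall (0 : EuclideanSpace ℝ (Fin n)) 1)))
    (hB : Nonempty (↥B ≃ₜ ↥(Metric.closedBall (0 : EuclideanSpace ℝ (Fin n)) 1)))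
    (hC : Nonempty (↥C ≃ₜ ↥(Metric.closedBall (0 : EuclideanSpace ℝ (Fin n)) 1))) :
    mInt n (Set.univ : Set M) = mInt n A ∪ mInt n B := by
  obtain ⟨α⟩ := hA
  obtain ⟨β⟩ := hB
  obtain ⟨γ⟩ := hC
  refine Subset.antisymm ?_ (union_subset (aux_mInt_subset hn hM A) (aux_mInt_subset hn hM B))
  have hcomp : CompactSpace (closedBall (0 : EuclideanSpace ℝ (Fin n)) 1) :=
    isCompact_iff_compactSpace.mp (isCompact_closedBall _ _)
  have hAc : IsClosed A := (isCompact_iff_compactSpace.mpr α.symm.compactSpace).isClosed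
  have hBc : IsClosed B := (isCompact_iff_compactSpace.mpr β.symm.compactSpace).isClosed
  rintro x ⟨-, U, hxU, -, hUo, ⟨φ⟩⟩
  have hU : IsOpen U := by
    obtain ⟨V, hV, e⟩ := isOpen_induced_iff.mp hUo
    have : V = U := by
      ext m
      have := congrArg (fun s => (⟨m, trivial⟩ : (univ : Set M)) ∈ s) e
      simpa using this
    rwa [← this]
  by_contra hnot
  have hnA : x ∉ mInt n A := fun h => hnot (Or.inl h)
  have hnB : x ∉ mInt n B := fun h => hnot (Or.inr h)
  have hcov : ∀ m, m ∈ A ∨ m ∈ B := fun m => (hAB ▸ mem_univ m : m ∈ A ∪ B)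
  have hxB : x ∈ B := by
    by_contra h
    refine hnA (aux_mInt_of_local hxU φ (hU.inter hBc.isOpen_compl) ⟨hxU, h⟩ ?_)
    ext m
    have := hcov m
    simp only [mem_inter_iff, mem_compl_iff]
    tauto
  have hxA : x ∈ A := by
    by_contra h
    refine hnB (aux_mInt_of_local hxU φ (hU.inter hAc.isOpen_compl) ⟨hxU, h⟩ ?_)
    ext m
    have := hcov m
    simp only [mem_inter_iff, mem_compl_iff]
    tauto
  have hxC : x ∈ C := hABC ▸ ⟨hxA, hxB⟩
  have hle : ∀ b : closedBall (0 : EuclideanSpace ℝ (Fin n)) 1, ‖(b : EuclideanSpace ℝ (Fin n))‖ ≤ 1 :=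
    fun b => mem_closedBall_zero_iff.mp b.2
  have h1 := (hle (α ⟨x, hxA⟩)).eq_of_not_lt fun h => hnA (aux_mInt_of_lt α hxA h)
  have h2 := (hle (β ⟨x, hxB⟩)).eq_of_not_lt fun h => hnB (aux_mInt_of_lt β hxB h)
  have h3 := (hle (γ ⟨x, hxC⟩)).eq_of_not_lt fun h =>
    hnA (aux_mInt_of_mInt_sub (hABC ▸ inter_subset_left) α (aux_mInt_of_lt γ hxC h))
  exact aux_key hAc hBc hAB hABC α β γ hxA hxB hxC h1 h2 h3 hU hxU φ
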